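/- Let R be a commutative ring with unit and A a finitely generated R-algebra. Let F : A → A be an R-algebra endomorphism and let f be the induced continuous self-map of Id(A) (the space of proper ideals with the constructible topology), given by f(𝔄) = F⁻¹(𝔄). Then the topological entropy of f is 0. -/

import Mathlib

open Set Filter
open scoped ENNReal

/-- The set `Id(A)` of proper ideals of `A`. -/
def ProperIdeal (A : Type*) [CommRing A] : Type _ := {I : Ideal A // I ≠ ⊤}

/-- The characteristic-function embedding `Id(A) → {0,1}^A`. -/
noncomputable def idealChi (A : Type*) [CommRing A] : ProperIdeal A → (A → Bool) :=
  fun I a => @decide (a ∈ I.1) (Classical.propDecidable _)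

/-- The constructible topology on `Id(A)`. -/
noncomputable def conTop (A : Type*) [CommRing A] : TopologicalSpace (ProperIdeal A) :=
  TopologicalSpace.induced (idealChi A) inferInstance

/-- `dynN f U n` is the complexity `N(𝔘ₙ)` of the joint cover
`𝔘ₙ = 𝔘 ∨ f⁻¹𝔘 ∨ ⋯ ∨ f⁻⁽ⁿ⁻¹⁾𝔘`. -/
noncomputable def dynN {X : Type*} (f : X → X) (U : Finset (Set X)) (n : ℕ) : ℕ :=
  sInf {m : ℕ | ∃ c : Fin m → Fin n → Set X,
    (∀ (j : Fin m) (i : Fin n), c j i ∈ U) ∧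
      (⋃ j : Fin m, ⋂ i : Fin n, f^[(i : ℕ)] ⁻¹' c j i) = Set.univ}

/-- Topological entropy defined via finite open covers. -/
noncomputable def coverEntropy {X : Type*} [TopologicalSpace X] (f : X → X) : ℝ≥0∞ :=
  ⨆ (U : Finset (Set X)) (_ : ∀ u ∈ U, IsOpen u) (_ : ⋃₀ (U : Set (Set X)) = Set.univ),
    Filter.limsup (fun n : ℕ => ENNReal.ofReal (Real.log (dynN f U n)) / (n : ℝ≥0∞))
      Filter.atTop

/-! ### Families of finite sets of naturals of positive density -/

/-- If every window start admits a sparse window of bounded length, then every window is sparse. -/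
lemma card_inter_Ico_le_of_sparse_windows (S : Finset ℕ) {c : ℝ} (hc : 0 ≤ c) (k : ℕ)
    (h : ∀ p, ∃ m, 1 ≤ m ∧ m ≤ k ∧ ((S ∩ Finset.Ico p (p + m)).card : ℝ) ≤ c * m) (n : ℕ) :
    ∀ p, ((S ∩ Finset.Ico p (p + n)).card : ℝ) ≤ c * (n + k) := by
  induction n using Nat.strong_induction_on with
  | _ n ih =>
    intro p
    obtain ⟨m, hm1, hmk, hm⟩ := h p
    rcases le_or_gt n m with hnm | hmn
    · have hsub : S ∩ Finset.Ico p (p + n) ⊆ S ∩ Finset.Ico p (p + m) :=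
        Finset.inter_subset_inter_left (Finset.Ico_subset_Ico_right (by omega))
      calc ((S ∩ Finset.Ico p (p + n)).card : ℝ)
          ≤ (S ∩ Finset.Ico p (p + m)).card := by exact_mod_cast Finset.card_le_card hsub
        _ ≤ c * m := hm
        _ ≤ c * (n + k) := by
          gcongr
          exact_mod_cast hmk.trans (Nat.le_add_left _ _)
    · have hsub : S ∩ Finset.Ico p (p + n) ⊆
          (S ∩ Finset.Ico p (p + m)) ∪ (S ∩ Finset.Ico (p + m) (p + m + (n - m))) := by
        intro x
        simp only [Finset.mem_inter, Finset.mem_union, Finset.mem_Ico]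
        grind
      have hcard := (Finset.card_le_card hsub).trans (Finset.card_union_le _ _)
      have hrest := ih (n - m) (by omega) (p + m)
      rw [Nat.cast_sub hmn.le] at hrest
      have hcard' : ((S ∩ Finset.Ico p (p + n)).card : ℝ) ≤ (S ∩ Finset.Ico p (p + m)).card +
          (S ∩ Finset.Ico (p + m) (p + m + (n - m))).card := by exact_mod_cast hcard
      linarith

/-- A hereditary family of finite sets of naturals, stable under left translation and containing
sets of a fixed positive density in arbitrarily long initial segments, contains all finite subsets
of some infinite set. -/
lemma exists_infinite_of_frequently_dense {P : Finset ℕ → Prop}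
    (hmono : ∀ S T, P S → T ⊆ S → P T)
    (hshift : ∀ (S : Finset ℕ) (k : ℕ), P (S.image (· + k)) → P S)
    {c : ℝ} (hc : 0 < c)
    (hdense : ∃ᶠ n : ℕ in atTop, ∃ S ⊆ Finset.range n, P S ∧ c * n ≤ S.card) :
    ∃ J : Set ℕ, J.Infinite ∧ ∀ T : Finset ℕ, (T : Set ℕ) ⊆ J → P T := by
  have hS : ∀ k : ℕ, ∃ S : Finset ℕ, P S ∧ ∀ m, 1 ≤ m → m ≤ k →
      c / 2 * m < ((S ∩ Finset.range m).card : ℝ) := by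
    intro k
    obtain ⟨n, hn, S, hSn, hPS, hcard⟩ := Filter.frequently_atTop.1 hdense (k + 1)
    obtain ⟨p, hp⟩ : ∃ p, ∀ m, 1 ≤ m → m ≤ k →
        c / 2 * m < ((S ∩ Finset.Ico p (p + m)).card : ℝ) := by
      by_contra! hcon
      have hle := card_inter_Ico_le_of_sparse_windows S (half_pos hc).le k hcon n 0
      have hSeq : S ∩ Finset.Ico 0 (0 + n) = S := by
        rw [zero_add, ← Finset.range_eq_Ico, Finset.inter_eq_left]
        exact hSn
      rw [hSeq] at hle
      have hkn : (k : ℝ) + 1 ≤ n := by exact_mod_cast hn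
      nlinarith
    refine ⟨(S ∩ Finset.Ico p (p + k)).image (· - p), hshift _ p (hmono S _ hPS ?_), ?_⟩
    · intro x
      simp only [Finset.mem_image, Finset.mem_inter, Finset.mem_Ico]
      grind
    · intro m hm1 hmk
      refine (hp m hm1 hmk).trans_le ?_
      rw [← Finset.card_image_of_injective ((S ∩ Finset.Ico p (p + k)).image (· - p) ∩
        Finset.range m) (add_left_injective p)]
      norm_cast
      refine Finset.card_le_card fun x hx => ?_
      simp only [Finset.mem_inter, Finset.mem_Ico] at hx
      simp only [Finset.mem_image, Finset.mem_inter, Finset.mem_Ico, Finset.mem_range]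
      exact ⟨x - p, ⟨⟨x, by grind, rfl⟩, by grind⟩, by grind⟩
  choose S hPS hScard using hS
  let J : Set ℕ := {i | ∀ᶠ k in (hyperfilter ℕ : Filter ℕ), i ∈ S k}
  refine ⟨J, fun hJ => ?_, fun T hT => ?_⟩
  · obtain ⟨m, hm⟩ := exists_nat_gt (hJ.toFinset.card / (c / 2))
    have hev : ∀ᶠ k in (hyperfilter ℕ : Filter ℕ), ∀ i ∈ Finset.range (m + 1), i ∈ S k → i ∈ J := by
      rw [Filter.eventually_all_finset]
      intro i _
      by_cases hi : i ∈ J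
      · exact Filter.Eventually.of_forall fun _ _ => hi
      · exact (Ultrafilter.eventually_not.2 hi).mono fun _ h h' => absurd h' h
    have hge : ∀ᶠ k in (hyperfilter ℕ : Filter ℕ), m + 1 ≤ k :=
      Nat.hyperfilter_le_atTop (eventually_ge_atTop (m + 1))
    obtain ⟨k, hk, hmk⟩ := (hev.and hge).exists
    have hlt := hScard k (m + 1) (by omega) hmk
    have hle : (S k ∩ Finset.range (m + 1)).card ≤ hJ.toFinset.card :=
      Finset.card_le_card fun i hi => by
        rw [Finset.mem_inter] at hi
        simpa using hk i hi.2 hi.1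
    rw [div_lt_iff₀ (half_pos hc)] at hm
    have hle' : ((S k ∩ Finset.range (m + 1)).card : ℝ) ≤ hJ.toFinset.card := by exact_mod_cast hle
    push_cast at hlt
    nlinarith
  · have hev : ∀ᶠ k in (hyperfilter ℕ : Filter ℕ), ∀ i ∈ T, i ∈ S k := by
      rw [Filter.eventually_all_finset]
      exact fun i hi => hT hi
    obtain ⟨k, hk⟩ := hev.exists
    exact hmono _ _ (hPS k) hk

/-- A set family shattering only small sets is small. -/
lemma card_le_exp_of_shatters_card_le {n : ℕ} {𝒜 : Finset (Finset ℕ)} {c L : ℝ} (hL : 0 ≤ L)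
    (hrange : ∀ s ∈ 𝒜, s ⊆ Finset.range n)
    (hcard : ∀ s, 𝒜.Shatters s → (s.card : ℝ) ≤ c * n) :
    (𝒜.card : ℝ) ≤ Real.exp (n * (Real.exp (-L) + L * c)) := by
  have hsub : 𝒜.shatterer ⊆ (Finset.range n).powerset := by
    intro s hs
    obtain ⟨t, ht, hst⟩ := (Finset.mem_shatterer.1 hs).exists_superset
    exact Finset.mem_powerset.2 (hst.trans (hrange t ht))
  have hsum : (𝒜.shatterer.card : ℝ) * Real.exp (-(L * (c * n))) ≤ (1 + Real.exp (-L)) ^ n := by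
    calc (𝒜.shatterer.card : ℝ) * Real.exp (-(L * (c * n)))
        = ∑ s ∈ 𝒜.shatterer, Real.exp (-(L * (c * n))) := by simp
      _ ≤ ∑ s ∈ 𝒜.shatterer, ∏ i ∈ s, Real.exp (-L) := by
        refine Finset.sum_le_sum fun s hs => ?_
        rw [Finset.prod_const, ← Real.exp_nat_mul, Real.exp_le_exp]
        have := hcard s (Finset.mem_shatterer.1 hs)
        nlinarith
      _ ≤ ∑ s ∈ (Finset.range n).powerset, ∏ i ∈ s, Real.exp (-L) :=
        Finset.sum_le_sum_of_subset_of_nonneg hsub fun _ _ _ => by positivity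
      _ = (1 + Real.exp (-L)) ^ n := by
        rw [← Finset.prod_one_add]
        simp
  have hpow : (1 + Real.exp (-L)) ^ n ≤ Real.exp (n * Real.exp (-L)) := by
    rw [Real.exp_nat_mul]
    have := Real.add_one_le_exp (Real.exp (-L))
    gcongr
    linarith
  calc (𝒜.card : ℝ) ≤ 𝒜.shatterer.card := by exact_mod_cast 𝒜.card_le_card_shatterer
    _ = 𝒜.shatterer.card * Real.exp (-(L * (c * n))) * Real.exp (L * (c * n)) := by
      rw [mul_assoc, ← Real.exp_add]
      simp
    _ ≤ Real.exp (n * Real.exp (-L)) * Real.exp (L * (c * n)) := by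
      gcongr
      exact hsum.trans hpow
    _ = Real.exp (n * (Real.exp (-L) + L * c)) := by
      rw [← Real.exp_add]
      ring_nf

/-! ### Orbits in a finitely generated algebra -/

/-- Every orbit of an endomorphism of a finitely generated algebra lies in a Noetherian subring. -/
lemma exists_isNoetherianRing_subring_orbit_mem {R A : Type*} [CommRing R] [CommRing A]
    [Algebra R A] [Algebra.FiniteType R A] (F : A →ₐ[R] A) (a : A) :
    ∃ B : Subring A, IsNoetherianRing B ∧ ∀ i : ℕ, F^[i] a ∈ B := by
  classical
  obtain ⟨s, hs⟩ := (Algebra.FiniteType.out : (⊤ : Subalgebra R A).FG)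
  let B : Finset R → Subring A := fun C => Subring.closure (algebraMap R A '' C ∪ s)
  have hmono : ∀ {C D : Finset R}, C ⊆ D → B C ≤ B D := fun h =>
    Subring.closure_mono (union_subset_union_left _ (image_mono (by exact_mod_cast h)))
  have hcoeff : ∀ y : A, ∃ C : Finset R, y ∈ B C := by
    intro y
    have hy : y ∈ Algebra.adjoin R (s : Set A) := hs ▸ Algebra.mem_top
    induction hy using Algebra.adjoin_induction with
    | mem x hx => exact ⟨∅, Subring.subset_closure (Or.inr hx)⟩
    | algebraMap r => exact ⟨{r}, Subring.subset_closure (Or.inl ⟨r, by simp, rfl⟩)⟩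
    | add x y _ _ hx hy =>
      obtain ⟨C, hC⟩ := hx
      obtain ⟨D, hD⟩ := hy
      exact ⟨C ∪ D, add_mem (hmono Finset.subset_union_left hC)
        (hmono Finset.subset_union_right hD)⟩
    | mul x y _ _ hx hy =>
      obtain ⟨C, hC⟩ := hx
      obtain ⟨D, hD⟩ := hy
      exact ⟨C ∪ D, mul_mem (hmono Finset.subset_union_left hC)
        (hmono Finset.subset_union_right hD)⟩
  choose C hC using hcoeff
  let D : Finset R := C a ∪ s.biUnion fun x => C (F x)
  have hF : B D ≤ (B D).comap F.toRingHom := by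
    refine Subring.closure_le.2 ?_
    rintro x (⟨r, hr, rfl⟩ | hx)
    · have : F (algebraMap R A r) ∈ B D := by
        rw [F.commutes]
        exact Subring.subset_closure (Or.inl ⟨r, hr, rfl⟩)
      exact this
    · exact hmono ((Finset.subset_biUnion_of_mem (fun x => C (F x)) hx).trans
        Finset.subset_union_right) (hC (F x))
  refine ⟨B D, is_noetherian_subring_closure _
    ((D.finite_toSet.image _).union s.finite_toSet), fun i => ?_⟩
  induction i with
  | zero => exact hmono Finset.subset_union_left (hC a)
  | succ i ih =>
    rw [Function.iterate_succ_apply']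
    exact hF ih

/-- A finite set of times is independent for the orbit of `a` if every subset of it is the set of
times at which the orbit lies in some ideal. -/
def OrbitIndep {A : Type*} [CommRing A] (F : A →+* A) (a : A) (S : Finset ℕ) : Prop :=
  ∀ T ⊆ S, ∃ I : Ideal A, ∀ i ∈ S, F^[i] a ∈ I ↔ i ∈ T

lemma OrbitIndep.mono {A : Type*} [CommRing A] {F : A →+* A} {a : A} {S S' : Finset ℕ}
    (h : OrbitIndep F a S) (hS : S' ⊆ S) : OrbitIndep F a S' := fun T hT =>
  (h T (hT.trans hS)).imp fun _ hI i hi => hI i (hS hi)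

lemma OrbitIndep.of_image_add {A : Type*} [CommRing A] {F : A →+* A} {a : A} {S : Finset ℕ} {k : ℕ}
    (h : OrbitIndep F a (S.image (· + k))) : OrbitIndep F a S := by
  intro T hT
  obtain ⟨I, hI⟩ := h (T.image (· + k)) (Finset.image_subset_image hT)
  refine ⟨I.comap (F ^ k), fun i hi => ?_⟩
  have := hI (i + k) (Finset.mem_image_of_mem _ hi)
  rw [(add_left_injective k).mem_finset_image] at this
  rw [← this, Ideal.mem_comap, RingHom.coe_pow, ← Function.iterate_add_apply, add_comm]

/-- An orbit inside a Noetherian subring admits no infinite independent set of times. -/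
lemma not_infinite_of_forall_orbitIndep {A : Type*} [CommRing A] {F : A →+* A} {a : A}
    (B : Subring A) [IsNoetherianRing B] (hB : ∀ i : ℕ, F^[i] a ∈ B) {J : Set ℕ}
    (hJ : ∀ T : Finset ℕ, (T : Set ℕ) ⊆ J → OrbitIndep F a T) : ¬ J.Infinite := by
  classical
  intro hinf
  let b : ℕ → B := fun i => ⟨F^[i] a, hB i⟩
  let g : ℕ →o Ideal B :=
    ⟨fun n => Ideal.span (b '' {i | i ∈ J ∧ i < n}), fun m n hmn =>
      Ideal.span_mono (image_mono fun i hi => ⟨hi.1, hi.2.trans_le hmn⟩)⟩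
  obtain ⟨n, hn⟩ := monotone_stabilizes_iff_noetherian.2 ‹IsNoetherianRing B› g
  obtain ⟨j, hjJ, hnj⟩ := hinf.exists_gt n
  have hmem : b j ∈ g j := by
    rw [← hn j hnj.le, hn (j + 1) (by omega)]
    exact Ideal.subset_span ⟨j, ⟨hjJ, Nat.lt_succ_self j⟩, rfl⟩
  let T : Finset ℕ := (Finset.range j).filter (· ∈ J)
  have hTJ : ((insert j T : Finset ℕ) : Set ℕ) ⊆ J := by
    intro i
    simp only [T, Finset.coe_insert, mem_insert_iff, Finset.mem_coe, Finset.mem_filter]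
    rintro (rfl | hi)
    exacts [hjJ, hi.2]
  obtain ⟨I, hI⟩ := hJ _ hTJ T (Finset.subset_insert _ _)
  have hle : g j ≤ I.comap B.subtype := by
    refine Ideal.span_le.2 ?_
    rintro _ ⟨i, ⟨hiJ, hij⟩, rfl⟩
    have hiT : i ∈ T := by simp [T, hiJ, hij]
    exact (hI i (Finset.mem_insert_of_mem hiT)).2 hiT
  have : j ∈ T := (hI j (Finset.mem_insert_self _ _)).1 (hle hmem)
  simp [T] at this

open Classical in
/-- The sets of times below `n` at which the orbit of `a` lies in some ideal. -/
noncomputable def orbitPatterns {A : Type*} [CommRing A] (F : A →+* A) (a : A) (n : ℕ) :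
    Finset (Finset ℕ) :=
  (Finset.range n).powerset.filter fun T => ∃ I : Ideal A, ∀ i ∈ Finset.range n,
    F^[i] a ∈ I ↔ i ∈ T

lemma orbitIndep_of_shatters {A : Type*} [CommRing A] {F : A →+* A} {a : A} {n : ℕ} {S : Finset ℕ}
    (hS : (orbitPatterns F a n).Shatters S) : S ⊆ Finset.range n ∧ OrbitIndep F a S := by
  classical
  have hsub : S ⊆ Finset.range n := by
    obtain ⟨t, ht, hst⟩ := hS.exists_superset
    exact hst.trans (Finset.mem_powerset.1 (Finset.mem_filter.1 ht).1)
  refine ⟨hsub, fun T hT => ?_⟩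
  obtain ⟨u, hu, rfl⟩ := hS hT
  obtain ⟨I, hI⟩ := (Finset.mem_filter.1 hu).2
  exact ⟨I, fun i hi => by simp [hI i (hsub hi), hi]⟩

/-- The number of patterns of an orbit grows subexponentially. -/
lemma eventually_card_orbitPatterns_le {A : Type*} [CommRing A] {F : A →+* A} {a : A}
    (B : Subring A) [IsNoetherianRing B] (hB : ∀ i : ℕ, F^[i] a ∈ B) {ε : ℝ} (hε : 0 < ε) :
    ∀ᶠ n : ℕ in atTop, ((orbitPatterns F a n).card : ℝ) ≤ Real.exp (ε * n) := by
  classical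
  have hc : 0 < ε ^ 2 / 4 := by positivity
  have hev : ∀ᶠ n : ℕ in atTop, ¬ ∃ S ⊆ Finset.range n, OrbitIndep F a S ∧
      ε ^ 2 / 4 * n ≤ S.card := by
    rw [← Filter.not_frequently]
    intro hfreq
    obtain ⟨J, hinf, hJ⟩ := exists_infinite_of_frequently_dense
      (fun _ _ h hST => OrbitIndep.mono h hST) (fun _ _ h => OrbitIndep.of_image_add h) hc hfreq
    exact not_infinite_of_forall_orbitIndep B hB hJ hinf
  filter_upwards [hev] with n hn
  have hL : 0 ≤ 2 / ε := by positivity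
  refine (card_le_exp_of_shatters_card_le (n := n) (c := ε ^ 2 / 4) hL
    (fun s hs => Finset.mem_powerset.1 (Finset.mem_filter.1 hs).1) fun s hs => ?_).trans ?_
  · by_contra! hlt
    exact hn ⟨s, (orbitIndep_of_shatters hs).1, (orbitIndep_of_shatters hs).2, hlt.le⟩
  · have hexp : Real.exp (-(2 / ε)) ≤ ε / 2 := by
      rw [Real.exp_neg, ← inv_div 2 ε]
      have := Real.add_one_le_exp (2 / ε)
      exact inv_anti₀ (by positivity) (by linarith)
    have hLc : 2 / ε * (ε ^ 2 / 4) = ε / 2 := by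
      field_simp
      norm_num
    rw [Real.exp_le_exp, hLc, mul_comm ε]
    gcongr
    linarith

/-! ### Covers of the space of proper ideals -/

/-- A constructible neighbourhood of a proper ideal is determined by finitely many elements. -/
lemma exists_finset_forall_mem_of_isOpen {A : Type*} [CommRing A] {u : Set (ProperIdeal A)}
    (hu : @IsOpen _ (conTop A) u) {I : ProperIdeal A} (hI : I ∈ u) :
    ∃ E : Finset A, ∀ J : ProperIdeal A, (∀ a ∈ E, a ∈ J.1 ↔ a ∈ I.1) → J ∈ u := by
  obtain ⟨v, hv, rfl⟩ := hu
  obtain ⟨E, w, hw, hEw⟩ := isOpen_pi_iff.1 hv _ hI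
  refine ⟨E, fun J hJ => hEw fun a ha => ?_⟩
  have : idealChi A J a = idealChi A I a := by simp [idealChi, hJ a ha]
  rw [this]
  exact (hw a ha).2

/-- An ultrafilter limit of proper ideals is a proper ideal. -/
def ultraLimIdeal {A ι : Type*} [CommRing A] (l : Ultrafilter ι) (I : ι → ProperIdeal A) :
    ProperIdeal A :=
  ⟨{ carrier := {a | ∀ᶠ i in (l : Filter ι), a ∈ (I i).1}
     add_mem' := fun ha hb => by
      filter_upwards [ha, hb] with i hai hbi using add_mem hai hbi
     zero_mem' := Filter.Eventually.of_forall fun i => zero_mem _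
     smul_mem' := fun c _ ha => Filter.Eventually.mono ha fun i hai => (I i).1.smul_mem c hai },
    fun htop => by
      have h1 : ∀ᶠ i in (l : Filter ι), (1 : A) ∈ (I i).1 := (Ideal.eq_top_iff_one _).1 htop
      obtain ⟨i, hi⟩ := h1.exists
      exact (I i).2 ((Ideal.eq_top_iff_one _).2 hi)⟩

/-- A constructible open cover is refined by the partition into the membership patterns of a finite
set of elements. -/
lemma exists_finset_refining_cover {A : Type*} [CommRing A] {U : Finset (Set (ProperIdeal A))}
    (hU : ∀ u ∈ U, @IsOpen _ (conTop A) u) (hcov : ⋃₀ (U : Set (Set (ProperIdeal A))) = Set.univ) :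
    ∃ E : Finset A, ∀ I : ProperIdeal A, ∃ u ∈ U, ∀ J : ProperIdeal A,
      (∀ a ∈ E, a ∈ J.1 ↔ a ∈ I.1) → J ∈ u := by
  classical
  by_contra! hcon
  choose I hI using hcon
  let l : Ultrafilter (Finset A) := Ultrafilter.of atTop
  obtain ⟨u, hu, hIu⟩ : ultraLimIdeal l I ∈ ⋃₀ (U : Set (Set (ProperIdeal A))) :=
    hcov ▸ mem_univ _
  obtain ⟨E, hE⟩ := exists_finset_forall_mem_of_isOpen (hU u hu) hIu
  have hagree : ∀ᶠ D in (l : Filter (Finset A)), ∀ a ∈ E,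
      a ∈ (I D).1 ↔ a ∈ (ultraLimIdeal l I).1 := by
    rw [Filter.eventually_all_finset]
    intro a _
    by_cases ha : a ∈ (ultraLimIdeal l I).1
    · exact Filter.Eventually.mono ha fun D hD => iff_of_true hD ha
    · exact (Ultrafilter.eventually_not.2 ha).mono fun D hD => iff_of_false hD ha
  have hge : ∀ᶠ D in (l : Filter (Finset A)), E ⊆ D :=
    Ultrafilter.of_le atTop (eventually_ge_atTop E)
  obtain ⟨D, hD, hED⟩ := (hagree.and hge).exists
  obtain ⟨J, hJ, hJu⟩ := hI D u hu
  exact hJu (hE J fun a ha => (hJ a (hED ha)).trans (hD a ha))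

lemma mem_iterate_iff {A : Type*} [CommRing A] {F : A →+* A} {f : ProperIdeal A → ProperIdeal A}
    (hf : ∀ I : ProperIdeal A, (f I).1 = Ideal.comap F I.1) (i : ℕ) (I : ProperIdeal A) (a : A) :
    a ∈ (f^[i] I).1 ↔ F^[i] a ∈ I.1 := by
  induction i generalizing a with
  | zero => rfl
  | succ i ih =>
    rw [Function.iterate_succ_apply', hf, Ideal.mem_comap, ih, Function.iterate_succ_apply]

lemma dynN_le_prod_card_orbitPatterns {A : Type*} [CommRing A] {F : A →+* A}
    {f : ProperIdeal A → ProperIdeal A}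
    (hf : ∀ I : ProperIdeal A, (f I).1 = Ideal.comap F I.1)
    {U : Finset (Set (ProperIdeal A))} {E : Finset A}
    (hE : ∀ I : ProperIdeal A, ∃ u ∈ U, ∀ J : ProperIdeal A,
      (∀ a ∈ E, a ∈ J.1 ↔ a ∈ I.1) → J ∈ u) (n : ℕ) :
    dynN f U n ≤ ∏ a ∈ E, (orbitPatterns F a n).card := by
  classical
  choose u huU hu using hE
  let code : ProperIdeal A → E → Finset ℕ := fun I a =>
    (Finset.range n).filter fun i => F^[i] a ∈ I.1
  let D : Finset (E → Finset ℕ) :=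
    (Fintype.piFinset fun a : E => orbitPatterns F (a : A) n).filter (· ∈ range code)
  have hcode : ∀ I, code I ∈ D := by
    intro I
    refine Finset.mem_filter.2 ⟨Fintype.mem_piFinset.2 fun a => Finset.mem_filter.2
      ⟨Finset.mem_powerset.2 (Finset.filter_subset _ _), I.1, fun i hi => ?_⟩, mem_range_self I⟩
    simp [code, Finset.mem_range.1 hi]
  have hD : D.card ≤ ∏ a ∈ E, (orbitPatterns F a n).card := by
    refine (Finset.card_filter_le _ _).trans_eq ?_
    rw [Fintype.card_piFinset, Finset.univ_eq_attach,
      Finset.prod_attach E fun a => (orbitPatterns F a n).card]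
  have hrep : ∀ d : D, ∃ I, code I = d := fun d => (Finset.mem_filter.1 d.2).2
  choose I hI using hrep
  refine (Nat.sInf_le ?_).trans hD
  refine ⟨fun j i => u (f^[i] (I (D.equivFin.symm j))), fun j i => huU _, ?_⟩
  refine eq_univ_of_forall fun J => mem_iUnion.2 ⟨D.equivFin ⟨code J, hcode J⟩,
    mem_iInter.2 fun i => hu _ _ fun a ha => ?_⟩
  rw [Equiv.symm_apply_apply, mem_iterate_iff hf, mem_iterate_iff hf]
  have h := congrArg (fun d => (i : ℕ) ∈ d ⟨a, ha⟩) (hI ⟨code J, hcode J⟩)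
  simpa [code] using h.symm

/-- Let `A` be a finitely generated `R`-algebra and `F : A → A` an `R`-algebra
endomorphism. The induced self-map `𝔄 ↦ F⁻¹(𝔄)` of `Id(A)` (with the constructible
topology) has zero topological entropy. -/
theorem stmt14 (R A : Type*) [CommRing R] [CommRing A] [Algebra R A]
    [Algebra.FiniteType R A] (F : A →ₐ[R] A)
    (f : ProperIdeal A → ProperIdeal A)
    (hf : ∀ I : ProperIdeal A, (f I).1 = Ideal.comap F.toRingHom I.1) :
    @coverEntropy (ProperIdeal A) (conTop A) f = 0 := by
  let _ : TopologicalSpace (ProperIdeal A) := conTop A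
  have hgrowth : ∀ a : A, ∀ ε : ℝ, 0 < ε → ∀ᶠ n : ℕ in atTop,
      ((orbitPatterns F.toRingHom a n).card : ℝ) ≤ Real.exp (ε * n) := by
    intro a ε hε
    obtain ⟨B, hB, horbit⟩ := exists_isNoetherianRing_subring_orbit_mem F a
    exact eventually_card_orbitPatterns_le B horbit hε
  simp only [coverEntropy, ENNReal.iSup_eq_zero]
  intro U hU hcov
  obtain ⟨E, hE⟩ := exists_finset_refining_cover hU hcov
  refine Filter.Tendsto.limsup_eq (ENNReal.tendsto_nhds_zero.2 fun ε hε => ?_)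
  obtain ⟨δ, hδ, hδε⟩ := ENNReal.lt_iff_exists_nnreal_btwn.1 hε
  have hδ0 : (0 : ℝ) < δ := by exact_mod_cast hδ
  have hη : 0 < (δ : ℝ) / (E.card + 1) := by positivity
  have hev : ∀ᶠ n : ℕ in atTop, ∀ a ∈ E, ((orbitPatterns F.toRingHom a n).card : ℝ) ≤
      Real.exp ((δ : ℝ) / (E.card + 1) * n) :=
    (Filter.eventually_all_finset E).2 fun a _ => hgrowth a _ hη
  filter_upwards [hev] with n hn
  have hdyn : (dynN f U n : ℝ) ≤ Real.exp (δ * n) := by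
    calc (dynN f U n : ℝ) ≤ ∏ a ∈ E, ((orbitPatterns F.toRingHom a n).card : ℝ) := by
          exact_mod_cast dynN_le_prod_card_orbitPatterns hf hE n
      _ ≤ ∏ a ∈ E, Real.exp ((δ : ℝ) / (E.card + 1) * n) :=
          Finset.prod_le_prod (fun _ _ => by positivity) hn
      _ = Real.exp (E.card / (E.card + 1) * (δ * n)) := by
          rw [Finset.prod_const, ← Real.exp_nat_mul]
          ring_nf
      _ ≤ Real.exp (δ * n) := by
          rw [Real.exp_le_exp]
          refine mul_le_of_le_one_left (by positivity) ?_
          rw [div_le_one (by positivity)]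
          linarith
  have hlog : Real.log (dynN f U n) ≤ δ * n := by
    rcases Nat.eq_zero_or_pos (dynN f U n) with h0 | hpos
    · rw [h0, Nat.cast_zero, Real.log_zero]
      positivity
    · exact (Real.log_le_iff_le_exp (by exact_mod_cast hpos)).2 hdyn
  refine (ENNReal.div_le_of_le_mul ?_).trans hδε.le
  calc ENNReal.ofReal (Real.log (dynN f U n)) ≤ ENNReal.ofReal (δ * n) :=
        ENNReal.ofReal_le_ofReal hlog
    _ = δ * n := by
        rw [ENNReal.ofReal_mul δ.coe_nonneg, ENNReal.ofReal_coe_nnreal, ENNReal.ofReal_natCast]
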